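/- arXiv:1908.09143 — 3 statements merged into one kernel-verified Lean document; each statement's English description precedes it below -/
import Mathlib

section
/- Let α ∈ (0,1) ∪ (1,2), let k be an odd integer and l an integer. Then ∫_0^π sin(η)^α·(−k²·sin(η) + 2ik·cos(η))·e^{i(k−2l)η} dη = i·sgn(k−2l) · (π·α·(1−α)·((α−1)k² + 4kl) / (2^{2+α}·cos(πα/2)·Γ(2−α))) · Γ((−1−α)/2 + |k−2l|/2)/Γ((3+α)/2 + |k−2l|/2). -/
open MeasureTheory Filter Set Real intervalIntegral

/-- The Fourier-type integral of a power of the sine over a half period. -/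
noncomputable def sinRpowFourier (s : ℝ) (c : ℂ) : ℂ :=
  ∫ η in (0:ℝ)..π, ((Real.sin η ^ s : ℝ) : ℂ) * Complex.exp (Complex.I * c * (η : ℂ))

lemma continuous_sin_rpow {s : ℝ} (hs : 0 ≤ s) :
    Continuous fun η : ℝ => ((Real.sin η ^ s : ℝ) : ℂ) :=
  Complex.continuous_ofReal.comp (Real.continuous_sin.rpow_const fun _ => Or.inr hs)

lemma continuous_sin_rpow_mul_exp {s : ℝ} (hs : 0 ≤ s) (c : ℂ) :
    Continuous fun η : ℝ =>
      ((Real.sin η ^ s : ℝ) : ℂ) * Complex.exp (Complex.I * c * (η : ℂ)) :=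
  (continuous_sin_rpow hs).mul (by fun_prop)

lemma continuous_sin_rpow_mul_cos_mul_exp {s : ℝ} (hs : 0 ≤ s) (c : ℂ) :
    Continuous fun η : ℝ => ((Real.sin η ^ s : ℝ) : ℂ) * (Real.cos η : ℂ)
      * Complex.exp (Complex.I * c * (η : ℂ)) :=
  ((continuous_sin_rpow hs).mul (by fun_prop)).mul (by fun_prop)

lemma sin_rpow_add_one {s η : ℝ} (hs : 0 ≤ s) (hη : η ∈ uIcc (0:ℝ) π) :
    Real.sin η ^ (s + 1) = Real.sin η ^ s * Real.sin η := by
  rw [uIcc_of_le Real.pi_pos.le] at hη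
  exact Real.rpow_add_one' (Real.sin_nonneg_of_mem_Icc hη) (by linarith)

/-- Integration by parts for `sin ^ s * cos`. -/
lemma integral_sin_rpow_mul_cos_mul_exp {s : ℝ} (hs : 0 ≤ s) (c : ℂ) :
    ((s : ℂ) + 1) * ∫ η in (0:ℝ)..π, ((Real.sin η ^ s : ℝ) : ℂ) * (Real.cos η : ℂ)
        * Complex.exp (Complex.I * c * (η : ℂ))
      = -(Complex.I * c) * sinRpowFourier (s + 1) c := by
  have hd : ∀ η ∈ uIcc (0:ℝ) π,
      HasDerivAt (fun η : ℝ => ((Real.sin η ^ (s + 1) : ℝ) : ℂ)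
          * Complex.exp (Complex.I * c * (η : ℂ)))
        (((s : ℂ) + 1) * (((Real.sin η ^ s : ℝ) : ℂ) * (Real.cos η : ℂ)
            * Complex.exp (Complex.I * c * (η : ℂ)))
          + Complex.I * c * (((Real.sin η ^ (s + 1) : ℝ) : ℂ)
            * Complex.exp (Complex.I * c * (η : ℂ)))) η := by
    intro η _
    have h1 := ((Real.hasDerivAt_sin η).rpow_const (p := s + 1)
      (Or.inr (by linarith))).ofReal_comp
    have h2 : HasDerivAt (fun η : ℝ => Complex.exp (Complex.I * c * (η : ℂ)))
        (Complex.exp (Complex.I * c * (η : ℂ)) * (Complex.I * c * 1)) η :=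
      (((hasDerivAt_id η).ofReal_comp).const_mul (Complex.I * c)).cexp
    convert! h1.mul h2 using 1
    push_cast [add_sub_cancel_right]
    ring
  have hc1 := continuous_sin_rpow_mul_cos_mul_exp hs c
  have hc2 := continuous_sin_rpow_mul_exp (by linarith : 0 ≤ s + 1) c
  have hint := integral_eq_sub_of_hasDerivAt hd
    (((hc1.const_mul _).add (hc2.const_mul _)).intervalIntegrable _ _)
  rw [integral_add ((hc1.const_mul _).intervalIntegrable _ _)
    ((hc2.const_mul _).intervalIntegrable _ _), intervalIntegral.integral_const_mul,
    intervalIntegral.integral_const_mul] at hint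
  simp only [Real.sin_pi, Real.sin_zero, Real.zero_rpow (by linarith : s + 1 ≠ 0),
    Complex.ofReal_zero, zero_mul, sub_zero] at hint
  rw [sinRpowFourier]
  linear_combination hint

lemma sinRpowFourier_add_two {s : ℝ} (hs : 0 ≤ s) (c : ℂ) :
    ((s : ℂ) + 2 + c) * sinRpowFourier s (c + 2) = (c - s) * sinRpowFourier s c := by
  have hP := (continuous_sin_rpow_mul_cos_mul_exp hs (c + 1)).intervalIntegrable
    (μ := volume) 0 π
  have hQ := ((continuous_sin_rpow_mul_exp (by linarith : 0 ≤ s + 1) (c + 1)).const_mul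
    Complex.I).intervalIntegrable (μ := volume) 0 π
  have hQ' : ∀ η ∈ uIcc (0:ℝ) π, ((Real.sin η ^ (s + 1) : ℝ) : ℂ)
      = ((Real.sin η ^ s : ℝ) : ℂ) * Complex.sin η := by
    intro η hη
    rw [sin_rpow_add_one hs hη]
    push_cast
    rfl
  have h1 : sinRpowFourier s (c + 2)
      = (∫ η in (0:ℝ)..π, ((Real.sin η ^ s : ℝ) : ℂ) * (Real.cos η : ℂ)
          * Complex.exp (Complex.I * (c + 1) * (η : ℂ)))
        + Complex.I * sinRpowFourier (s + 1) (c + 1) := by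
    rw [sinRpowFourier, sinRpowFourier, ← intervalIntegral.integral_const_mul,
      ← integral_add hP hQ]
    refine integral_congr fun η hη => ?_
    have : Complex.exp (Complex.I * (c + 2) * η)
        = (Complex.cos η + Complex.sin η * Complex.I) * Complex.exp (Complex.I * (c + 1) * η) := by
      rw [← Complex.exp_mul_I, ← Complex.exp_add]
      ring_nf
    simp only [this, hQ' η hη, Complex.ofReal_cos]
    ring
  have h2 : sinRpowFourier s c
      = (∫ η in (0:ℝ)..π, ((Real.sin η ^ s : ℝ) : ℂ) * (Real.cos η : ℂ)
          * Complex.exp (Complex.I * (c + 1) * (η : ℂ)))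
        - Complex.I * sinRpowFourier (s + 1) (c + 1) := by
    rw [sinRpowFourier, sinRpowFourier, ← intervalIntegral.integral_const_mul,
      ← integral_sub hP hQ]
    refine integral_congr fun η hη => ?_
    have : Complex.exp (Complex.I * c * η)
        = (Complex.cos η - Complex.sin η * Complex.I) * Complex.exp (Complex.I * (c + 1) * η) := by
      rw [← Complex.cos_neg, sub_eq_add_neg, ← neg_mul, ← Complex.sin_neg, ← Complex.exp_mul_I,
        ← Complex.exp_add]
      ring_nf
    simp only [this, hQ' η hη, Complex.ofReal_cos]
    ring
  rw [h1, h2]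
  linear_combination 2 * integral_sin_rpow_mul_cos_mul_exp hs (c + 1)

lemma sinRpowFourier_neg_of_odd (s : ℝ) {m : ℤ} (hm : Odd m) :
    sinRpowFourier s (-m) = -sinRpowFourier s m := by
  have h := integral_comp_sub_left (a := 0) (b := π)
    (fun η : ℝ => ((Real.sin η ^ s : ℝ) : ℂ) * Complex.exp (Complex.I * m * (η : ℂ))) π
  rw [sub_self, sub_zero] at h
  rw [sinRpowFourier, sinRpowFourier, ← h, ← intervalIntegral.integral_neg]
  refine integral_congr fun η _ => ?_
  have hexp : Complex.exp (Complex.I * m * ((π - η : ℝ) : ℂ))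
      = -Complex.exp (Complex.I * -m * η) := by
    have : Complex.I * m * ((π - η : ℝ) : ℂ) = m * (π * Complex.I) + Complex.I * -m * η := by
      push_cast
      ring
    rw [this, Complex.exp_add, Complex.exp_int_mul, Complex.exp_pi_mul_I, hm.neg_one_zpow]
    ring
  simp only [hexp, Real.sin_pi_sub]
  ring

lemma integral_sin_rpow {s : ℝ} (hs : 1 ≤ s) :
    ∫ η in (0:ℝ)..π, Real.sin η ^ s
      = 2 ^ s * (Real.Gamma ((s + 1) / 2) ^ 2 / Real.Gamma (s + 1)) := by
  have hcont : Continuous fun u : ℝ => 2 ^ s * (u * (1 - u)) ^ ((s - 1) / 2) :=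
    ((continuous_id.mul (continuous_const.sub continuous_id)).rpow_const
      fun _ => Or.inr (by linarith)).const_mul _
  have hsub := integral_comp_mul_deriv (a := 0) (b := π)
    (f := fun η : ℝ => (1 - Real.cos η) / 2) (f' := fun η => Real.sin η / 2)
    (g := fun u : ℝ => 2 ^ s * (u * (1 - u)) ^ ((s - 1) / 2))
    (fun η _ => by simpa using ((Real.hasDerivAt_cos η).const_sub 1).div_const 2)
    (by fun_prop) hcont
  have hbeta : ((∫ u in (0:ℝ)..1, (u * (1 - u)) ^ ((s - 1) / 2) : ℝ) : ℂ)
      = Complex.betaIntegral (((s + 1) / 2 : ℝ)) (((s + 1) / 2 : ℝ)) := by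
    rw [Complex.betaIntegral, ← intervalIntegral.integral_ofReal]
    refine integral_congr fun u hu => ?_
    rw [uIcc_of_le zero_le_one] at hu
    have h1 : 0 ≤ 1 - u := by linarith [hu.2]
    have he : (((s + 1) / 2 : ℝ) : ℂ) - 1 = (((s - 1) / 2 : ℝ) : ℂ) := by
      push_cast
      ring
    rw [Real.mul_rpow hu.1 h1, he, Complex.ofReal_mul, Complex.ofReal_cpow hu.1,
      Complex.ofReal_cpow h1]
    push_cast
    rfl
  have hval : ∫ u in (0:ℝ)..1, (u * (1 - u)) ^ ((s - 1) / 2)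
      = Real.Gamma ((s + 1) / 2) ^ 2 / Real.Gamma (s + 1) := by
    have hre : 0 < ((((s + 1) / 2 : ℝ)) : ℂ).re := by
      rw [Complex.ofReal_re]
      linarith
    rw [← Complex.ofReal_inj, hbeta, Complex.betaIntegral_eq_Gamma_mul_div _ _ hre hre,
      ← Complex.ofReal_add, add_halves, Complex.Gamma_ofReal, Complex.Gamma_ofReal]
    push_cast
    ring
  rw [← hval, ← intervalIntegral.integral_const_mul]
  norm_num at hsub
  rw [← intervalIntegral.integral_const_mul] at hsub
  rw [← hsub]
  refine integral_congr fun η hη => ?_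
  rw [uIcc_of_le Real.pi_pos.le] at hη
  have hsin := Real.sin_nonneg_of_mem_Icc hη
  have hsq : (1 - Real.cos η) / 2 * (1 - (1 - Real.cos η) / 2) = (Real.sin η / 2) ^ 2 := by
    linear_combination (-1/4) * Real.sin_sq_add_cos_sq η
  have hpow : (Real.sin η / 2) ^ s
      = ((Real.sin η / 2) ^ 2) ^ ((s - 1) / 2) * (Real.sin η / 2) := by
    rw [← Real.rpow_natCast, ← Real.rpow_mul (by positivity),
      ← Real.rpow_add_one' (by positivity) (by push_cast; linarith)]
    congr 1
    push_cast
    ring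
  simp only [hsq]
  rw [mul_assoc, ← hpow, Real.div_rpow hsin (by norm_num)]
  field_simp

lemma sinRpowFourier_one {s : ℝ} (hs : 0 ≤ s) :
    sinRpowFourier s 1 = Complex.I * ((∫ η in (0:ℝ)..π, Real.sin η ^ (s + 1) : ℝ) : ℂ) := by
  have h0 := integral_sin_rpow_mul_cos_mul_exp hs 0
  have hs' : ((s : ℂ) + 1) ≠ 0 := by
    exact_mod_cast (by linarith : s + 1 ≠ 0)
  simp only [mul_zero, zero_mul, neg_zero, Complex.exp_zero, mul_one, mul_eq_zero, hs',
    false_or] at h0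
  have hc1 : IntervalIntegrable
      (fun η : ℝ => ((Real.sin η ^ s : ℝ) : ℂ) * (Real.cos η : ℂ)) volume 0 π :=
    ((continuous_sin_rpow hs).mul (by fun_prop)).intervalIntegrable 0 π
  have hc2 := ((continuous_sin_rpow (by linarith : 0 ≤ s + 1)).const_mul
    Complex.I).intervalIntegrable (μ := volume) 0 π
  rw [← intervalIntegral.integral_ofReal, ← intervalIntegral.integral_const_mul,
    ← zero_add (∫ η in (0:ℝ)..π, _), ← h0, ← integral_add hc1 hc2, sinRpowFourier]
  refine integral_congr fun η hη => ?_
  simp only [sin_rpow_add_one hs hη, mul_one]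
  rw [mul_comm Complex.I, Complex.exp_mul_I]
  push_cast
  ring

lemma two_rpow_mul_Gamma_sq_div_Gamma {α : ℝ} (h0 : 0 < α) (h2 : α < 2) (h1 : α ≠ 1) :
    2 ^ (α + 2) * (Real.Gamma ((α + 2 + 1) / 2) ^ 2 / Real.Gamma (α + 2 + 1))
      = -(π * α * (1 - α) * (α + 1) / (2 ^ (2 + α) * Real.cos (π * α / 2) * Real.Gamma (2 - α))
        * (Real.Gamma ((-1 - α) / 2 + 1 / 2) / Real.Gamma ((3 + α) / 2 + 1 / 2))) := by
  have hsin : Real.sin (π * α / 2) ≠ 0 :=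
    (Real.sin_pos_of_pos_of_lt_pi (by positivity) (by nlinarith [Real.pi_pos])).ne'
  have hcos : Real.cos (π * α / 2) ≠ 0 := by
    rw [← Real.sin_pi_div_two_sub]
    rcases lt_or_gt_of_ne h1 with h | h
    · exact (Real.sin_pos_of_pos_of_lt_pi (by nlinarith [Real.pi_pos])
        (by nlinarith [Real.pi_pos])).ne'
    · exact (Real.sin_neg_of_neg_of_neg_pi_lt (by nlinarith [Real.pi_pos])
        (by nlinarith [Real.pi_pos])).ne
  have hα1 : 1 - α ≠ 0 := sub_ne_zero.2 h1.symm
  have hdup := Real.Gamma_mul_Gamma_add_half ((α + 3) / 2)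
  have hA := Real.Gamma_mul_Gamma_one_sub α
  have hB := Real.Gamma_mul_Gamma_one_sub (α / 2)
  have e1 : Real.Gamma (2 - α) = (1 - α) * Real.Gamma (1 - α) := by
    rw [← Real.Gamma_add_one hα1]; ring_nf
  have e2 : Real.Gamma (1 - α / 2) = (-α / 2) * Real.Gamma (-α / 2) := by
    rw [← Real.Gamma_add_one (by linarith)]; ring_nf
  have e3 : Real.Gamma (α / 2 + 2) = (α / 2 + 1) * (α / 2 * Real.Gamma (α / 2)) := by
    rw [← Real.Gamma_add_one (by linarith), ← Real.Gamma_add_one (by linarith)]; ring_nf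
  have e4 : Real.Gamma (α + 3) = (α + 2) * ((α + 1) * (α * Real.Gamma α)) := by
    rw [← Real.Gamma_add_one h0.ne', ← Real.Gamma_add_one (by linarith),
      show α + 2 = α + 1 + 1 by ring, ← Real.Gamma_add_one (by linarith)]; ring_nf
  rw [show (α + 3) / 2 + 1 / 2 = α / 2 + 2 by ring, show 2 * ((α + 3) / 2) = α + 3 by ring,
    show 1 - (α + 3) = -(α + 2) by ring, Real.rpow_neg (by norm_num), e3, e4] at hdup
  rw [show π * (α / 2) = π * α / 2 by ring, e2] at hB
  rw [show π * α = 2 * (π * α / 2) by ring, Real.sin_two_mul] at hA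
  rw [show (-1 - α) / 2 + 1 / 2 = -α / 2 by ring, show (3 + α) / 2 + 1 / 2 = α / 2 + 2 by ring,
    show α + 2 + 1 = α + 3 by ring, show 2 + α = α + 2 by ring, e1, e3, e4]
  have hGα : 0 < Real.Gamma α := Real.Gamma_pos_of_pos h0
  have hGα2 : 0 < Real.Gamma (α / 2) := Real.Gamma_pos_of_pos (by linarith)
  have hp : (0:ℝ) < 2 ^ (α + 2) := by positivity
  have hπ := Real.sq_sqrt Real.pi_pos.le
  have hX : Real.Gamma ((α + 3) / 2) = (α + 2) * ((α + 1) * (α * Real.Gamma α))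
      * (2 ^ (α + 2))⁻¹ * √π / ((α / 2 + 1) * (α / 2 * Real.Gamma (α / 2))) := by
    rw [eq_div_iff (by positivity)]; exact hdup
  have hY : Real.Gamma (1 - α)
      = π / (2 * Real.sin (π * α / 2) * Real.cos (π * α / 2)) / Real.Gamma α := by
    rw [eq_div_iff hGα.ne', mul_comm]; exact hA
  have hZ : Real.Gamma (-α / 2)
      = π / Real.sin (π * α / 2) / Real.Gamma (α / 2) / (-α / 2) := by
    rw [eq_div_iff (by linarith), eq_div_iff hGα2.ne']; linear_combination hB
  rw [hX, hY, hZ]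
  generalize Real.sin (π * α / 2) = S at hsin
  generalize Real.cos (π * α / 2) = C at hcos
  have hα3 : α + 2 ≠ 0 := by linarith
  have hα4 : α + 1 ≠ 0 := by linarith
  have hπ0 := Real.pi_pos
  field_simp
  rw [hπ]

lemma sinRpowFourier_odd_nat {α : ℝ} (h0 : 0 < α) (h2 : α < 2) (h1 : α ≠ 1) (n : ℕ) :
    sinRpowFourier (α + 1) (2 * n + 1)
      = -Complex.I * ((π * α * (1 - α) * (α + 1)
        / (2 ^ (2 + α) * Real.cos (π * α / 2) * Real.Gamma (2 - α))
        * (Real.Gamma ((-1 - α) / 2 + (2 * n + 1) / 2)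
          / Real.Gamma ((3 + α) / 2 + (2 * n + 1) / 2)) : ℝ) : ℂ) := by
  induction n with
  | zero =>
    have h := two_rpow_mul_Gamma_sq_div_Gamma h0 h2 h1
    simp only [Nat.cast_zero, mul_zero, zero_add]
    rw [sinRpowFourier_one (by linarith), integral_sin_rpow (by linarith),
      show α + 1 + 1 = α + 2 by ring, h]
    push_cast
    ring
  | succ n ih =>
    have hrec := sinRpowFourier_add_two (by linarith : 0 ≤ α + 1) (2 * n + 1)
    rw [ih] at hrec
    have hn : (0:ℝ) ≤ n := n.cast_nonneg
    have ha : (-1 - α) / 2 + (2 * (n:ℝ) + 1) / 2 ≠ 0 := by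
      rcases n with _ | n
      · norm_num; linarith
      · push_cast; nlinarith [(n.cast_nonneg : (0:ℝ) ≤ n)]
    have hb : 0 < (3 + α) / 2 + (2 * (n:ℝ) + 1) / 2 := by linarith
    have hne : (((α + 1 : ℝ) : ℂ) + 2 + (2 * n + 1)) ≠ 0 := by
      exact_mod_cast (by linarith : (α + 1 : ℝ) + 2 + (2 * n + 1) ≠ 0)
    apply mul_left_cancel₀ hne
    have ec : (2 * ((n + 1 : ℕ) : ℂ) + 1) = 2 * n + 1 + 2 := by push_cast; ring
    rw [ec, hrec]
    have ea : (-1 - α) / 2 + (2 * ((n + 1 : ℕ) : ℝ) + 1) / 2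
        = (-1 - α) / 2 + (2 * (n:ℝ) + 1) / 2 + 1 := by push_cast; ring
    have eb : (3 + α) / 2 + (2 * ((n + 1 : ℕ) : ℝ) + 1) / 2
        = (3 + α) / 2 + (2 * (n:ℝ) + 1) / 2 + 1 := by push_cast; ring
    rw [ea, eb, Real.Gamma_add_one ha, Real.Gamma_add_one hb.ne']
    generalize π * α * (1 - α) * (α + 1)
        / (2 ^ (2 + α) * Real.cos (π * α / 2) * Real.Gamma (2 - α)) = K
    have hG := (Real.Gamma_pos_of_pos hb).ne'
    generalize Real.Gamma ((3 + α) / 2 + (2 * (n:ℝ) + 1) / 2) = G at hG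
    generalize Real.Gamma ((-1 - α) / 2 + (2 * (n:ℝ) + 1) / 2) = F
    have key : (2 * (n:ℝ) + 1 - (α + 1)) * (K * (F / G))
        = (α + 1 + 2 + (2 * n + 1)) * (K * (((-1 - α) / 2 + (2 * (n:ℝ) + 1) / 2) * F
          / (((3 + α) / 2 + (2 * (n:ℝ) + 1) / 2) * G))) := by
      field_simp
      ring
    have key' := congrArg (fun x : ℝ => (x : ℂ)) key
    push_cast at key' ⊢
    linear_combination (-Complex.I) * key'

lemma sinRpowFourier_odd_int {α : ℝ} (h0 : 0 < α) (h2 : α < 2) (h1 : α ≠ 1) {m : ℤ}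
    (hm : Odd m) :
    sinRpowFourier (α + 1) m
      = -Complex.I * (Int.sign m : ℂ) * ((π * α * (1 - α) * (α + 1)
        / (2 ^ (2 + α) * Real.cos (π * α / 2) * Real.Gamma (2 - α))
        * (Real.Gamma ((-1 - α) / 2 + |(m : ℝ)| / 2)
          / Real.Gamma ((3 + α) / 2 + |(m : ℝ)| / 2)) : ℝ) : ℂ) := by
  wlog hpos : 0 < m generalizing m
  · have hneg : 0 < -m := by
      have : m ≠ 0 := by rintro rfl; simp at hm
      omega
    have h := this hm.neg hneg
    rw [Int.cast_neg, sinRpowFourier_neg_of_odd _ hm] at h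
    rw [← neg_neg (sinRpowFourier _ _), h, Int.sign_neg, Int.cast_neg, Int.cast_neg, abs_neg]
    ring
  obtain ⟨j, rfl⟩ := hm
  lift j to ℕ using by omega
  have h := sinRpowFourier_odd_nat h0 h2 h1 j
  rw [Int.sign_eq_one_of_pos hpos, abs_of_pos (by exact_mod_cast hpos)]
  push_cast at h ⊢
  rw [h]
  ring

/-- Evaluation of the integral I₂ for odd k (equation (33) of the paper). -/
theorem stmt_11 (α : ℝ) (hα : α ∈ Set.Ioo (0:ℝ) 1 ∪ Set.Ioo (1:ℝ) 2)
    (k : ℤ) (hk : Odd k) (l : ℤ) :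
    ∫ η in (0:ℝ)..π,
        ((Real.sin η ^ α : ℝ) : ℂ)
          * (-(k : ℂ) ^ 2 * (Real.sin η : ℂ) + 2 * Complex.I * (k : ℂ) * (Real.cos η : ℂ))
          * Complex.exp (Complex.I * ((k : ℂ) - 2 * (l : ℂ)) * (η : ℂ))
      = Complex.I * (Int.sign (k - 2 * l) : ℂ)
          * ((π * α * (1 - α) * ((α - 1) * (k : ℝ) ^ 2 + 4 * (k : ℝ) * (l : ℝ))
              / (2 ^ (2 + α) * Real.cos (π * α / 2) * Real.Gamma (2 - α))
              * (Real.Gamma ((-1 - α) / 2 + |(k : ℝ) - 2 * (l : ℝ)| / 2)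
                / Real.Gamma ((3 + α) / 2 + |(k : ℝ) - 2 * (l : ℝ)| / 2)) : ℝ) : ℂ) := by
  have h0 : 0 < α := by rcases hα with h | h <;> linarith [h.1]
  have h2 : α < 2 := by rcases hα with h | h <;> linarith [h.2]
  have h1 : α ≠ 1 := by
    rcases hα with h | h
    · exact h.2.ne
    · exact h.1.ne'
  have hm : Odd (k - 2 * l) := hk.sub_even (even_two_mul l)
  have hS := sinRpowFourier_odd_int h0 h2 h1 hm
  have hibp := integral_sin_rpow_mul_cos_mul_exp h0.le ((k : ℂ) - 2 * (l : ℂ))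
  push_cast at hS
  have hP := ((continuous_sin_rpow_mul_cos_mul_exp h0.le ((k : ℂ) - 2 * (l : ℂ))).const_mul
    (2 * Complex.I * (k : ℂ))).intervalIntegrable (μ := volume) 0 π
  have hQ := ((continuous_sin_rpow_mul_exp (by linarith : 0 ≤ α + 1)
    ((k : ℂ) - 2 * (l : ℂ))).const_mul (-(k : ℂ) ^ 2)).intervalIntegrable (μ := volume) 0 π
  have hsplit : ∫ η in (0:ℝ)..π,
        ((Real.sin η ^ α : ℝ) : ℂ)
          * (-(k : ℂ) ^ 2 * (Real.sin η : ℂ) + 2 * Complex.I * (k : ℂ) * (Real.cos η : ℂ))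
          * Complex.exp (Complex.I * ((k : ℂ) - 2 * (l : ℂ)) * (η : ℂ))
      = -(k : ℂ) ^ 2 * sinRpowFourier (α + 1) ((k : ℂ) - 2 * (l : ℂ))
        + 2 * Complex.I * (k : ℂ) * ∫ η in (0:ℝ)..π, ((Real.sin η ^ α : ℝ) : ℂ)
          * (Real.cos η : ℂ) * Complex.exp (Complex.I * ((k : ℂ) - 2 * (l : ℂ)) * (η : ℂ)) := by
    rw [sinRpowFourier, ← intervalIntegral.integral_const_mul,
      ← intervalIntegral.integral_const_mul, ← integral_add hQ hP]
    refine integral_congr fun η hη => ?_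
    simp only [sin_rpow_add_one h0.le hη, Complex.ofReal_mul]
    ring
  have hne : (α : ℂ) + 1 ≠ 0 := by exact_mod_cast (by linarith : α + 1 ≠ 0)
  apply mul_left_cancel₀ hne
  rw [hsplit, mul_add, mul_left_comm ((α : ℂ) + 1) (2 * Complex.I * (k : ℂ)), hibp, hS]
  push_cast
  generalize Complex.cos _ = C
  ring_nf
  simp only [Complex.I_pow_three]
  ring
end

section
/- Let α ∈ (0,2) with α ≠ 1, and let m be an odd integer. Then Γ((−1−α+m)/2)/Γ((3+α+m)/2) = −Γ((−1−α−m)/2)/Γ((3+α−m)/2), where Γ is the real Gamma function (all four arguments are non-integers for α ∈ (0,2)\{1} and m odd, so no poles occur). -/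
open Real

theorem Gamma_add_odd_mul_Gamma_one_sub (s : ℝ) {m : ℤ} (hm : Odd m) :
    Real.Gamma (s + m) * Real.Gamma (1 - (s + m)) = -(Real.Gamma s * Real.Gamma (1 - s)) := by
  rw [Real.Gamma_mul_Gamma_one_sub, Real.Gamma_mul_Gamma_one_sub,
    show π * (s + m) = π * s + m * π by ring, Real.sin_add_int_mul_pi, hm.neg_one_zpow,
    neg_one_mul, div_neg]

theorem Gamma_half_add_int_ne_zero {α : ℝ} (hα : α ∈ Set.Ioo (0 : ℝ) 2) (k : ℤ) :
    Real.Gamma (α / 2 + k) ≠ 0 := by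
  refine Real.Gamma_ne_zero fun n hn => ?_
  obtain ⟨h0, h2⟩ := hα
  have hpos : (0 : ℝ) < ((-n - k : ℤ) : ℝ) := by push_cast; linarith
  have hlt : ((-n - k : ℤ) : ℝ) < 1 := by push_cast; linarith
  norm_cast at hpos hlt
  lia

/-- Half-odd-shift reflection identity for the Gamma function (odd case). -/
theorem stmt_13 (α : ℝ) (hα : α ∈ Set.Ioo (0:ℝ) 2) (hα1 : α ≠ 1) (m : ℤ) (hm : Odd m) :
    Real.Gamma ((-1 - α + (m : ℝ)) / 2) / Real.Gamma ((3 + α + (m : ℝ)) / 2)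
      = -(Real.Gamma ((-1 - α - (m : ℝ)) / 2) / Real.Gamma ((3 + α - (m : ℝ)) / 2)) := by
  have hrefl := Gamma_add_odd_mul_Gamma_one_sub ((-1 - α - (m : ℝ)) / 2) hm
  rw [show (-1 - α - (m : ℝ)) / 2 + m = (-1 - α + m) / 2 by ring,
    show 1 - (-1 - α + (m : ℝ)) / 2 = (3 + α - m) / 2 by ring,
    show 1 - (-1 - α - (m : ℝ)) / 2 = (3 + α + m) / 2 by ring] at hrefl
  obtain ⟨k, rfl⟩ := hm
  have hplus : Real.Gamma ((3 + α + ((2 * k + 1 : ℤ) : ℝ)) / 2) ≠ 0 := by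
    convert Gamma_half_add_int_ne_zero hα (k + 2) using 2
    push_cast; ring
  have hminus : Real.Gamma ((3 + α - ((2 * k + 1 : ℤ) : ℝ)) / 2) ≠ 0 := by
    convert Gamma_half_add_int_ne_zero hα (1 - k) using 2
    push_cast; ring
  rw [← neg_div, div_eq_div_iff hplus hminus, hrefl, neg_mul]
end

section
/- Let α ∈ (0,1) ∪ (1,2), let k be an even integer, and let s ∈ (0,π). Then ∫_0^π sin(η)^α·(−k²·sin(η) + 2ik·cos(η))·e^{ikη}·|sin(s−η)|^{1−α} dη = Σ_{l ∈ ℤ} d_{k,l}·e^{2ils}, where d_{k,l} = (cot(πα/2)/8)·α·(1−α)·((1−α)k² − 4kl)·Γ((α−1)/2 + |l|)·Γ((−1−α)/2 + |k/2 − l|) / ( Γ((3−α)/2 + |l|)·Γ((3+α)/2 + |k/2 − l|) ), and the series over l ∈ ℤ converges absolutely. -/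
open MeasureTheory Filter Set Real intervalIntegral

theorem integral_rpow_mul_one_sub {x : ℝ} (hx : 0 < x) :
    IntegrableOn (fun u : ℝ => (u * (1 - u)) ^ (x - 1)) (Ioo 0 1) ∧
      ∫ u in Ioo (0 : ℝ) 1, (u * (1 - u)) ^ (x - 1) = Gamma x * Gamma x / Gamma (2 * x) := by
  have hcongr : ∀ u ∈ Ioo (0 : ℝ) 1,
      (u : ℂ) ^ ((x : ℂ) - 1) * (1 - (u : ℂ)) ^ ((x : ℂ) - 1)
        = (((u * (1 - u)) ^ (x - 1) : ℝ) : ℂ) := by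
    intro u hu
    have h1 : 0 ≤ 1 - u := by linarith [hu.2]
    rw [Real.mul_rpow hu.1.le h1, Complex.ofReal_mul, Complex.ofReal_cpow hu.1.le,
      Complex.ofReal_cpow h1]
    push_cast
    rfl
  have hint := Complex.betaIntegral_convergent (u := x) (v := x) (by simpa) (by simpa)
  rw [intervalIntegrable_iff_integrableOn_Ioo_of_le zero_le_one] at hint
  have hint' := (integrableOn_congr_fun hcongr measurableSet_Ioo).1 hint
  refine ⟨hint'.re, ?_⟩
  have hval := Complex.betaIntegral_eq_Gamma_mul_div x x (by simpa) (by simpa)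
  rw [Complex.betaIntegral, intervalIntegral.integral_of_le zero_le_one,
    integral_Ioc_eq_integral_Ioo, setIntegral_congr_fun measurableSet_Ioo hcongr,
    integral_complex_ofReal, ← two_mul] at hval
  rw [← Complex.ofReal_ofNat, ← Complex.ofReal_mul, Complex.Gamma_ofReal,
    Complex.Gamma_ofReal] at hval
  exact_mod_cast hval

theorem image_one_sub_cos_div_two :
    (fun t : ℝ => (1 - cos t) / 2) '' Ioo 0 π = Ioo 0 1 := by
  ext u
  constructor
  · rintro ⟨t, ht, rfl⟩
    have h1 : cos t < 1 := by
      simpa using Real.cos_lt_cos_of_nonneg_of_le_pi le_rfl ht.2.le ht.1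
    have h2 : -1 < cos t := by
      simpa using Real.cos_lt_cos_of_nonneg_of_le_pi ht.1.le le_rfl ht.2
    constructor <;> dsimp only <;> linarith
  · rintro ⟨h0, h1⟩
    refine ⟨arccos (1 - 2 * u), ⟨Real.arccos_pos.2 (by linarith), ?_⟩, ?_⟩
    · exact Real.arccos_lt_pi.2 (by linarith)
    · dsimp only
      rw [Real.cos_arccos (by linarith) (by linarith)]
      ring

theorem integral_sin_rpow_Ioo {a : ℝ} (ha : -1 < a) :
    IntegrableOn (fun t : ℝ => sin t ^ a) (Ioo 0 π) ∧
      ∫ t in Ioo 0 π, sin t ^ a = √π * Gamma ((a + 1) / 2) / Gamma (a / 2 + 1) := by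
  have hx : 0 < (a + 1) / 2 := by linarith
  obtain ⟨hint, hval⟩ := integral_rpow_mul_one_sub hx
  have hderiv : ∀ t ∈ Ioo 0 π,
      HasDerivWithinAt (fun t : ℝ => (1 - cos t) / 2) (sin t / 2) (Ioo 0 π) t := by
    intro t _
    simpa using (((hasDerivAt_cos t).const_sub 1).div_const 2).hasDerivWithinAt
  have hinj : InjOn (fun t : ℝ => (1 - cos t) / 2) (Ioo 0 π) := by
    intro t ht t' ht' h
    refine Real.injOn_cos (Ioo_subset_Icc_self ht) (Ioo_subset_Icc_self ht') ?_
    dsimp only at h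
    linarith
  have hcongr : ∀ t ∈ Ioo 0 π,
      |sin t / 2| • ((1 - cos t) / 2 * (1 - (1 - cos t) / 2)) ^ ((a + 1) / 2 - 1)
        = (2 ^ a)⁻¹ * sin t ^ a := by
    intro t ht
    have hs : 0 < sin t := sin_pos_of_mem_Ioo ht
    have hs2 : 0 < sin t / 2 := by positivity
    have h1 : (1 - cos t) / 2 * (1 - (1 - cos t) / 2) = (sin t / 2) ^ (2 : ℝ) := by
      rw [Real.rpow_two]
      nlinarith [sin_sq_add_cos_sq t]
    rw [h1, ← Real.rpow_mul hs2.le, abs_of_pos hs2, smul_eq_mul]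
    nth_rewrite 1 [← Real.rpow_one (sin t / 2)]
    rw [← Real.rpow_add hs2, show 1 + 2 * ((a + 1) / 2 - 1) = a by ring,
      Real.div_rpow hs.le zero_le_two]
    ring
  have h2 : (2 : ℝ) ^ a ≠ 0 := by positivity
  rw [← image_one_sub_cos_div_two,
    integrableOn_image_iff_integrableOn_abs_deriv_smul measurableSet_Ioo hderiv hinj,
    integrableOn_congr_fun hcongr measurableSet_Ioo] at hint
  rw [← image_one_sub_cos_div_two,
    integral_image_eq_integral_abs_deriv_smul measurableSet_Ioo hderiv hinj,
    setIntegral_congr_fun measurableSet_Ioo hcongr,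
    MeasureTheory.integral_const_mul] at hval
  refine ⟨?_, ?_⟩
  · have := hint.const_mul (2 ^ a)
    simpa [IntegrableOn, h2] using this
  · have hdup := Real.Gamma_mul_Gamma_add_half ((a + 1) / 2)
    rw [show 2 * ((a + 1) / 2) = a + 1 by ring] at hval hdup
    rw [show (a + 1) / 2 + 1 / 2 = a / 2 + 1 by ring, show 1 - (a + 1) = -a by ring,
      Real.rpow_neg zero_le_two] at hdup
    have g1 : Gamma (a + 1) ≠ 0 := (Gamma_pos_of_pos (by linarith)).ne'
    have g2 : Gamma (a / 2 + 1) ≠ 0 := (Gamma_pos_of_pos (by linarith)).ne'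
    rw [eq_div_iff g2]
    rw [eq_div_iff g1] at hval
    apply mul_left_cancel₀ g1
    apply mul_left_cancel₀ (inv_ne_zero h2)
    linear_combination Gamma (a / 2 + 1) * hval + Gamma ((a + 1) / 2) * hdup

theorem intervalIntegrable_sin_rpow_mul {a : ℝ} (ha : -1 < a) {g : ℝ → ℂ} (hg : Continuous g) :
    IntervalIntegrable (fun t : ℝ => ((sin t ^ a : ℝ) : ℂ) * g t) volume 0 π := by
  refine IntervalIntegrable.mul_continuousOn ?_ hg.continuousOn
  rw [intervalIntegrable_iff_integrableOn_Ioo_of_le pi_pos.le]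
  exact (integral_sin_rpow_Ioo ha).1.ofReal

theorem integral_sin_rpow_mul_deriv {a : ℝ} (ha : -1 < a) (β : ℂ) :
    ∫ t in (0 : ℝ)..π, ((sin t ^ a : ℝ) : ℂ)
      * (((a + 1) * (cos t : ℂ) + Complex.I * β * (sin t : ℂ)) * Complex.exp (Complex.I * β * t))
      = 0 := by
  have ha1 : 0 < a + 1 := by linarith
  have h := integral_eq_sub_of_hasDerivAt_of_le
    (f := fun t : ℝ => ((sin t ^ (a + 1) : ℝ) : ℂ) * Complex.exp (Complex.I * β * t))
    (f' := fun t : ℝ => ((sin t ^ a : ℝ) : ℂ)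
      * (((a + 1) * (cos t : ℂ) + Complex.I * β * (sin t : ℂ)) * Complex.exp (Complex.I * β * t)))
    pi_pos.le ?_ ?_ (intervalIntegrable_sin_rpow_mul ha (by fun_prop))
  · rw [h]
    simp [Real.zero_rpow ha1.ne']
  · have : Continuous fun t : ℝ => sin t ^ (a + 1) :=
      Real.continuous_sin.rpow_const fun _ => Or.inr ha1.le
    fun_prop
  · intro t ht
    have hs : 0 < sin t := sin_pos_of_mem_Ioo ht
    have h1 := ((hasDerivAt_sin t).rpow_const (p := a + 1) (Or.inl hs.ne')).ofReal_comp
    have h2 : HasDerivAt (fun t : ℝ => Complex.exp (Complex.I * β * t))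
        (Complex.exp (Complex.I * β * t) * (Complex.I * β)) t := by
      simpa using (((hasDerivAt_id (t : ℂ)).const_mul (Complex.I * β)).cexp).comp_ofReal
    refine (h1.mul h2).congr_deriv ?_
    rw [add_sub_cancel_right, Real.rpow_add hs, Real.rpow_one]
    push_cast
    ring

/-- The Fourier integral of `sin ^ a` on `(0, π)` at the even frequency `2 * n`. -/
noncomputable def sinMoment (a : ℝ) (n : ℤ) : ℂ :=
  ∫ t in (0 : ℝ)..π, ((sin t ^ a : ℝ) : ℂ) * Complex.exp (2 * Complex.I * n * t)

theorem sinMoment_zero {a : ℝ} (ha : -1 < a) :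
    sinMoment a 0 = ((√π * Gamma ((a + 1) / 2) / Gamma (a / 2 + 1) : ℝ) : ℂ) := by
  rw [← (integral_sin_rpow_Ioo ha).2, sinMoment, ← integral_complex_ofReal,
    intervalIntegral.integral_of_le pi_pos.le, integral_Ioc_eq_integral_Ioo]
  simp

theorem sinMoment_neg (a : ℝ) (n : ℤ) : sinMoment a (-n) = sinMoment a n := by
  have h := intervalIntegral.integral_comp_sub_left (a := 0) (b := π)
    (fun t : ℝ => ((sin t ^ a : ℝ) : ℂ) * Complex.exp (2 * Complex.I * n * t)) π
  rw [sub_self, sub_zero] at h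
  rw [sinMoment, sinMoment, ← h]
  congr 1
  ext t
  rw [sin_pi_sub]
  congr 1
  rw [show 2 * Complex.I * (n : ℂ) * ((π - t : ℝ) : ℂ)
      = 2 * Complex.I * ((-n : ℤ) : ℂ) * t + n * (2 * π * Complex.I) by push_cast; ring,
    Complex.exp_add, Complex.exp_int_mul_two_pi_mul_I, mul_one]

theorem sinMoment_succ {a : ℝ} (ha : -1 < a) (n : ℤ) :
    (2 * n + 2 + a) * sinMoment a (n + 1) = (2 * n - a) * sinMoment a n := by
  have h := integral_sin_rpow_mul_deriv ha (2 * n + 1)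
  have hcongr : ∀ t : ℝ, ((sin t ^ a : ℝ) : ℂ) * (((a + 1) * (cos t : ℂ)
        + Complex.I * (2 * n + 1) * (sin t : ℂ)) * Complex.exp (Complex.I * (2 * n + 1) * t))
      = (2 * n + 2 + a) / 2 * (((sin t ^ a : ℝ) : ℂ)
          * Complex.exp (2 * Complex.I * ((n + 1 : ℤ) : ℂ) * t))
        - (2 * n - a) / 2 * (((sin t ^ a : ℝ) : ℂ)
          * Complex.exp (2 * Complex.I * n * t)) := by
    intro t
    have e1 : Complex.exp (2 * Complex.I * ((n + 1 : ℤ) : ℂ) * t)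
        = Complex.exp (Complex.I * (2 * n + 1) * t) * Complex.exp (t * Complex.I) := by
      rw [← Complex.exp_add]; push_cast; ring_nf
    have e2 : Complex.exp (2 * Complex.I * n * t)
        = Complex.exp (Complex.I * (2 * n + 1) * t) * Complex.exp (-t * Complex.I) := by
      rw [← Complex.exp_add]; ring_nf
    rw [e1, e2, Complex.ofReal_cos, Complex.ofReal_sin, Complex.cos, Complex.sin]
    linear_combination (-((sin t ^ a : ℝ) : ℂ) * (2 * n + 1) / 2
      * Complex.exp (Complex.I * (2 * n + 1) * t)
      * (Complex.exp (t * Complex.I) - Complex.exp (-t * Complex.I))) * Complex.I_mul_I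
  simp_rw [hcongr] at h
  rw [intervalIntegral.integral_sub
      ((intervalIntegrable_sin_rpow_mul ha (by fun_prop)).const_mul _)
      ((intervalIntegrable_sin_rpow_mul ha (by fun_prop)).const_mul _),
    intervalIntegral.integral_const_mul, intervalIntegral.integral_const_mul] at h
  rw [sinMoment, sinMoment]
  linear_combination 2 * h

theorem sinMoment_natCast {a : ℝ} (ha : -1 < a) (h : ∀ m : ℕ, a ≠ 2 * m) (n : ℕ) :
    sinMoment a n = ((√π * Gamma ((a + 1) / 2) / Gamma (-a / 2)
      * (Gamma (-a / 2 + n) / Gamma (a / 2 + 1 + n)) : ℝ) : ℂ) := by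
  induction n with
  | zero =>
    have g : Gamma (-a / 2) ≠ 0 := Real.Gamma_ne_zero fun m hm => h m (by linarith)
    rw [Nat.cast_zero, sinMoment_zero ha]
    congr 1
    simp only [Nat.cast_zero, add_zero]
    generalize Gamma (-a / 2) = G at g ⊢
    field_simp
  | succ n ih =>
    have hrec := sinMoment_succ ha n
    have h1 : -a / 2 + n ≠ 0 := fun h' => h n (by linarith)
    have h2 : 0 < a / 2 + 1 + n := by
      have : (0 : ℝ) ≤ n := n.cast_nonneg
      linarith
    have h3 : (2 * ((n : ℤ) : ℂ) + 2 + a) ≠ 0 := by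
      have : 2 * (n : ℝ) + 2 + a ≠ 0 := by linarith
      exact_mod_cast this
    rw [Nat.cast_succ]
    apply mul_left_cancel₀ h3
    rw [hrec, ih, Nat.cast_succ, ← add_assoc, ← add_assoc, Real.Gamma_add_one h1,
      Real.Gamma_add_one h2.ne']
    have hratio (G H : ℝ) : (2 * n - a) * (G / H)
        = (2 * n + 2 + a) * ((-a / 2 + n) * G / ((a / 2 + 1 + n) * H)) := by
      rw [mul_div_mul_comm, ← mul_assoc]
      congr 1
      rw [mul_div_assoc', eq_div_iff h2.ne']
      ring
    have key (C G H : ℝ) : (2 * n - a) * (C * (G / H))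
        = (2 * n + 2 + a) * (C * ((-a / 2 + n) * G / ((a / 2 + 1 + n) * H))) := by
      linear_combination C * hratio G H
    exact_mod_cast key _ _ _

theorem sinMoment_eq {a : ℝ} (ha : -1 < a) (h : ∀ m : ℕ, a ≠ 2 * m) (n : ℤ) :
    sinMoment a n = ((√π * Gamma ((a + 1) / 2) / Gamma (-a / 2)
      * (Gamma (-a / 2 + |(n : ℝ)|) / Gamma (a / 2 + 1 + |(n : ℝ)|)) : ℝ) : ℂ) := by
  obtain ⟨m, rfl | rfl⟩ := n.eq_nat_or_neg
  · simpa using sinMoment_natCast ha h m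
  · rw [sinMoment_neg]
    simpa using sinMoment_natCast ha h m

theorem summable_Gamma_div_Gamma {x z : ℝ} (hxz : x + 1 < z) :
    Summable fun n : ℕ => Gamma (x + n) / Gamma (z + n) := by
  obtain ⟨N, hN⟩ := exists_nat_gt (-x)
  rw [← summable_nat_add_iff N]
  have hpos : ∀ n : ℕ, 0 < x + (n + N : ℕ) := by
    intro n
    push_cast
    have : (0 : ℝ) ≤ n := n.cast_nonneg
    linarith
  have hposz : ∀ n : ℕ, 0 < z - 1 + (n + N : ℕ) := fun n => by linarith [hpos n]
  set T : ℕ → ℝ := fun n => Gamma (x + (n + N : ℕ)) / Gamma (z - 1 + (n + N : ℕ)) with hT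
  have hTpos : ∀ n, 0 < T n := fun n =>
    div_pos (Gamma_pos_of_pos (hpos n)) (Gamma_pos_of_pos (hposz n))
  have hstep : ∀ n : ℕ, Gamma (x + (n + N : ℕ)) / Gamma (z + (n + N : ℕ))
      = (T n - T (n + 1)) / (z - 1 - x) := by
    intro n
    have e0 : z + (n + N : ℕ) = z - 1 + (n + N : ℕ) + 1 := by ring
    have e1 : x + (n + 1 + N : ℕ) = x + (n + N : ℕ) + 1 := by push_cast; ring
    have e2 : z - 1 + (n + 1 + N : ℕ) = z - 1 + (n + N : ℕ) + 1 := by push_cast; ring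
    have g := (Gamma_pos_of_pos (hposz n)).ne'
    have p := (hposz n).ne'
    have q : z - 1 - x ≠ 0 := by linarith
    rw [hT]
    dsimp only
    rw [e0, e1, e2, Real.Gamma_add_one p, Real.Gamma_add_one (hpos n).ne']
    generalize Gamma (z - 1 + (n + N : ℕ)) = G at *
    generalize Gamma (x + (n + N : ℕ)) = H at *
    generalize ((n + N : ℕ) : ℝ) = y at *
    field_simp
    ring
  refine summable_of_sum_range_le (c := T 0 / (z - 1 - x)) (fun n => ?_) fun n => ?_
  · refine div_nonneg (Gamma_pos_of_pos (hpos n)).le (Gamma_pos_of_pos ?_).le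
    linarith [hposz n]
  · simp_rw [hstep]
    rw [← Finset.sum_div, Finset.sum_range_sub']
    have : 0 < z - 1 - x := by linarith
    gcongr
    linarith [hTpos n]

theorem summable_add_abs_mul_Gamma_div_Gamma {x z : ℝ} (hz : 1 < z) (hxz : x + 2 < z) :
    Summable fun m : ℤ =>
      (z - 1 + |(m : ℝ)|) * |Gamma (x + |(m : ℝ)|) / Gamma (z + |(m : ℝ)|)| := by
  have hnat : Summable fun n : ℕ => (z - 1 + n) * |Gamma (x + n) / Gamma (z + n)| := by
    refine (summable_Gamma_div_Gamma (x := x) (z := z - 1) (by linarith)).abs.congr fun n => ?_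
    have hp : 0 < z - 1 + n := by
      have : (0 : ℝ) ≤ n := n.cast_nonneg
      linarith
    rw [show z + n = z - 1 + n + 1 by ring, Real.Gamma_add_one hp.ne', ← div_div, div_right_comm,
      abs_div _ (z - 1 + (n : ℝ)), abs_of_pos hp, mul_div_cancel₀ _ hp.ne']
  refine Summable.of_nat_of_neg ?_ ?_ <;> simpa using hnat

theorem periodic_abs_sin_rpow_mul_exp (b : ℝ) (l : ℤ) :
    Function.Periodic
      (fun t : ℝ => ((|sin t| ^ b : ℝ) : ℂ) * Complex.exp (2 * Complex.I * l * t)) π := by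
  intro t
  dsimp only
  rw [sin_add_pi, abs_neg]
  congr 1
  rw [show 2 * Complex.I * (l : ℂ) * ((t + π : ℝ) : ℂ)
      = 2 * Complex.I * l * t + l * (2 * π * Complex.I) by push_cast; ring,
    Complex.exp_add, Complex.exp_int_mul_two_pi_mul_I, mul_one]

theorem intervalIntegrable_abs_sin_sub_rpow {b : ℝ} (hb : -1 < b) (s : ℝ) :
    IntervalIntegrable (fun η : ℝ => |sin (s - η)| ^ b) volume 0 π := by
  have hper : Function.Periodic (fun t : ℝ => |sin t| ^ b) π := by
    intro t
    dsimp only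
    rw [sin_add_pi, abs_neg]
  have hint : IntervalIntegrable (fun t : ℝ => |sin t| ^ b) volume 0 π := by
    rw [intervalIntegrable_iff_integrableOn_Ioo_of_le pi_pos.le]
    refine (integral_sin_rpow_Ioo hb).1.congr_fun (fun t ht => ?_) measurableSet_Ioo
    dsimp only
    rw [abs_of_pos (sin_pos_of_mem_Ioo ht)]
  have := (hper.intervalIntegrable₀ pi_pos.ne' hint s (s - π)).comp_sub_left s
  simpa using this

theorem integral_exp_mul_abs_sin_sub_rpow (b : ℝ) (l : ℤ) (s : ℝ) :
    ∫ η in (0 : ℝ)..π, Complex.exp (2 * Complex.I * l * η) * ((|sin (s - η)| ^ b : ℝ) : ℂ)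
      = sinMoment b l * Complex.exp (2 * Complex.I * l * s) := by
  have hcongr : ∀ η : ℝ,
      Complex.exp (2 * Complex.I * l * η) * ((|sin (s - η)| ^ b : ℝ) : ℂ)
      = (((|sin (s - η)| ^ b : ℝ) : ℂ)
          * Complex.exp (2 * Complex.I * ((-l : ℤ) : ℂ) * ((s - η : ℝ) : ℂ)))
        * Complex.exp (2 * Complex.I * l * s) := by
    intro η
    rw [mul_assoc ((_ : ℝ) : ℂ), ← Complex.exp_add, mul_comm]
    congr 2
    push_cast
    ring
  simp_rw [hcongr]
  rw [intervalIntegral.integral_mul_const, ← sinMoment_neg]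
  congr 1
  have hshift := (periodic_abs_sin_rpow_mul_exp b (-l)).intervalIntegral_add_eq (s - π) 0
  rw [sub_add_cancel, zero_add] at hshift
  rw [intervalIntegral.integral_comp_sub_left (fun t : ℝ => ((|sin t| ^ b : ℝ) : ℂ)
    * Complex.exp (2 * Complex.I * ((-l : ℤ) : ℂ) * (t : ℂ))) s, sub_zero, hshift, sinMoment]
  refine intervalIntegral.integral_congr fun t ht => ?_
  rw [uIcc_of_le pi_pos.le] at ht
  rw [abs_of_nonneg (sin_nonneg_of_mem_Icc ht)]

theorem hasSum_fourier_of_summable {f : ℝ → ℂ} (hf : ContinuousOn f (Icc 0 π))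
    (hf0 : f 0 = f π) {c : ℤ → ℂ}
    (hc : ∀ l : ℤ, c l = 1 / π
      * ∫ t in (0 : ℝ)..π, Complex.exp (2 * Complex.I * (-l : ℤ) * t) * f t)
    (hsum : Summable c) {x : ℝ} (hx : x ∈ Ico 0 π) :
    HasSum (fun l : ℤ => c l * Complex.exp (2 * Complex.I * l * x)) (f x) := by
  have : Fact (0 < π) := ⟨pi_pos⟩
  have hexp (l : ℤ) (t : ℝ) :
      fourier l (t : AddCircle π) = Complex.exp (2 * Complex.I * l * t) := by
    rw [fourier_coe_apply]
    have : (π : ℂ) ≠ 0 := by exact_mod_cast pi_ne_zero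
    congr 1
    field_simp
  let F : C(AddCircle π, ℂ) := ⟨AddCircle.liftIco π 0 f,
    AddCircle.liftIco_zero_continuous hf0 hf⟩
  have hcoeff : fourierCoeff F = c := by
    ext l
    rw [hc]
    change fourierCoeff (AddCircle.liftIco π 0 f) l = _
    rw [fourierCoeff_eq_intervalIntegral _ _ 0, zero_add]
    rw [Complex.real_smul]
    push_cast
    congr 1
    refine intervalIntegral.integral_congr_Ioo_of_le pi_pos.le fun t ht => ?_
    rw [AddCircle.liftIco_zero_coe_apply (Ioo_subset_Ico_self ht), smul_eq_mul, hexp, Int.cast_neg]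
  have h := has_pointwise_sum_fourier_series_of_summable (f := F) (hcoeff ▸ hsum) (x : AddCircle π)
  have hFx : F (x : AddCircle π) = f x := AddCircle.liftIco_zero_coe_apply hx
  rw [hFx, hcoeff] at h
  simpa only [hexp, smul_eq_mul] using h

theorem hasSum_integral_mul_abs_sin_sub_rpow {b : ℝ} (hb : -1 < b) {f : ℝ → ℂ} {c : ℤ → ℂ}
    (hsum : Summable c)
    (hf : ∀ x ∈ Ioo 0 π, HasSum (fun l : ℤ => c l * Complex.exp (2 * Complex.I * l * x)) (f x))
    (s : ℝ) :
    HasSum (fun l : ℤ => c l * sinMoment b l * Complex.exp (2 * Complex.I * l * s))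
      (∫ η in (0 : ℝ)..π, f η * ((|sin (s - η)| ^ b : ℝ) : ℂ)) := by
  have hg := intervalIntegrable_abs_sin_sub_rpow hb s
  have key := intervalIntegral.hasSum_integral_of_dominated_convergence (μ := volume)
    (a := 0) (b := π)
    (F := fun (l : ℤ) (η : ℝ) => c l * (Complex.exp (2 * Complex.I * l * η)
      * ((|sin (s - η)| ^ b : ℝ) : ℂ)))
    (f := fun η : ℝ => f η * ((|sin (s - η)| ^ b : ℝ) : ℂ))
    (fun l η => ‖c l‖ * |sin (s - η)| ^ b) ?_ ?_ ?_ ?_ ?_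
  · refine key.congr_fun ?_
    intro l
    rw [intervalIntegral.integral_const_mul, integral_exp_mul_abs_sin_sub_rpow, mul_assoc]
  · intro l
    have : Continuous fun η : ℝ => c l * Complex.exp (2 * Complex.I * l * η) := by fun_prop
    have h2 := (hg.def'.ofReal (𝕜 := ℂ)).1
    exact (this.aestronglyMeasurable.mul h2).congr (.of_forall fun η => mul_assoc _ _ _)
  · refine fun l => .of_forall fun η _ => le_of_eq ?_
    rw [norm_mul, norm_mul, show 2 * Complex.I * (l : ℂ) * η = ((2 * l * η : ℝ) : ℂ) * Complex.I by
      push_cast; ring, Complex.norm_exp_ofReal_mul_I, one_mul, Complex.norm_real, Real.norm_eq_abs,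
      abs_of_nonneg (by positivity)]
  · exact .of_forall fun η _ => hsum.norm.mul_right _
  · simp_rw [tsum_mul_right]
    exact hg.const_mul _
  · have hne : ∀ᵐ η : ℝ, η ≠ π := by simp [ae_iff]
    filter_upwards [hne] with η hη hmem
    rw [uIoc_of_le pi_pos.le] at hmem
    simpa only [mul_assoc] using
      (hf η ⟨hmem.1, lt_of_le_of_ne hmem.2 hη⟩).mul_right ((|sin (s - η)| ^ b : ℝ) : ℂ)

theorem Gamma_mul_eq_cot {α : ℝ} (h0 : 0 < α) (h2 : α < 2) (h1 : α ≠ 1) :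
    √π * Gamma ((1 - α + 1) / 2) / Gamma (-(1 - α) / 2)
        * (√π * Gamma ((α + 1 + 1) / 2) / Gamma (-(α + 1) / 2))
      = π * (α + 1) * (cot (π * α / 2) / 8 * (α * (1 - α))) := by
  have hp : -(1 - α) / 2 ≠ 0 := fun h => h1 (by linarith)
  have hq : -(α + 1) / 2 ≠ 0 := by intro h; linarith
  have r1 := Real.Gamma_mul_Gamma_one_sub (α / 2)
  have r2 := Real.Gamma_mul_Gamma_one_sub ((α + 1) / 2)
  have e1 : Gamma ((α + 1) / 2) = -(1 - α) / 2 * Gamma (-(1 - α) / 2) := by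
    rw [← Real.Gamma_add_one hp]; congr 1; ring
  have e2 : Gamma (1 - (α + 1) / 2) = -(α + 1) / 2 * Gamma (-(α + 1) / 2) := by
    rw [← Real.Gamma_add_one hq]; congr 1; ring
  have e3 : Gamma ((α + 1 + 1) / 2) = α / 2 * Gamma (α / 2) := by
    rw [← Real.Gamma_add_one (by linarith)]; congr 1; ring
  rw [e1, e2, show π * ((α + 1) / 2) = π * α / 2 + π / 2 by ring, sin_add_pi_div_two] at r2
  rw [show (1 - α + 1) / 2 = 1 - α / 2 by ring, e3, Real.cot_eq_cos_div_sin]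
  rw [show π * (α / 2) = π * α / 2 by ring] at r1
  have g1 : Gamma (-(1 - α) / 2) ≠ 0 := by
    intro h
    rw [h, mul_zero] at e1
    exact (Gamma_pos_of_pos (by linarith)).ne' e1
  have hsin : sin (π * α / 2) ≠ 0 := by
    refine (sin_pos_of_pos_of_lt_pi (by positivity) ?_).ne'
    nlinarith [pi_pos]
  have g2 : Gamma (-(α + 1) / 2) ≠ 0 := by
    refine Real.Gamma_ne_zero fun m hm => ?_
    rcases m with _ | _ | m
    · push_cast at hm; linarith
    · push_cast at hm; exact h1 (by linarith)
    · push_cast at hm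
      have : (0 : ℝ) ≤ m := m.cast_nonneg
      linarith
  have hcos : cos (π * α / 2) ≠ 0 := by
    intro h
    rw [h, div_zero] at r2
    simp_all
  have hsq := Real.mul_self_sqrt pi_pos.le
  rw [eq_div_iff hsin] at r1
  rw [eq_div_iff hcos] at r2
  generalize Gamma (-(1 - α) / 2) = P at *
  generalize Gamma (-(α + 1) / 2) = Q at *
  generalize Gamma (α / 2) = R at *
  generalize Gamma (1 - α / 2) = S at *
  generalize sin (π * α / 2) = σ at *
  generalize cos (π * α / 2) = κ at *
  have : √π * S / P * (√π * (α / 2 * R) / Q) = √π * √π * (α / 2) * (R * S) / (P * Q) := by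
    field_simp
  rw [this, hsq, div_eq_iff (mul_ne_zero g1 g2)]
  apply mul_right_cancel₀ hsin
  rw [mul_assoc _ (R * S), r1, ← r2]
  field_simp
  ring

theorem integral_exp_mul_sin_rpow_mul {α : ℝ} (h0 : 0 < α) (j l : ℤ) :
    ∫ t in (0 : ℝ)..π, Complex.exp (2 * Complex.I * (-l : ℤ) * t)
      * (((sin t ^ α : ℝ) : ℂ)
        * (-(2 * j : ℂ) ^ 2 * (sin t : ℂ) + 2 * Complex.I * (2 * j) * (cos t : ℂ))
        * Complex.exp (Complex.I * (2 * j) * t))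
    = 2 * j / (α + 1) * ((1 - α) * (2 * j) - 4 * l) * sinMoment (α + 1) (j - l) := by
  have hα : (α : ℂ) + 1 ≠ 0 := by
    have : α + 1 ≠ 0 := by linarith
    exact_mod_cast this
  have h := integral_sin_rpow_mul_deriv (a := α) (by linarith) (2 * (j - l))
  have hcongr : ∀ t ∈ Ioo 0 π, Complex.exp (2 * Complex.I * (-l : ℤ) * t)
      * (((sin t ^ α : ℝ) : ℂ)
        * (-(2 * j : ℂ) ^ 2 * (sin t : ℂ) + 2 * Complex.I * (2 * j) * (cos t : ℂ))
        * Complex.exp (Complex.I * (2 * j) * t))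
      = 2 * j / (α + 1) * ((1 - α) * (2 * j) - 4 * l) * (((sin t ^ (α + 1) : ℝ) : ℂ)
          * Complex.exp (2 * Complex.I * ((j - l : ℤ) : ℂ) * t))
        + 2 * Complex.I * (2 * j) / (α + 1) * (((sin t ^ α : ℝ) : ℂ)
          * (((α + 1) * (cos t : ℂ) + Complex.I * (2 * (j - l)) * (sin t : ℂ))
            * Complex.exp (Complex.I * (2 * (j - l)) * t))) := by
    intro t ht
    have e1 : Complex.exp (2 * Complex.I * (-l : ℤ) * t) * Complex.exp (Complex.I * (2 * j) * t)
        = Complex.exp (Complex.I * (2 * (j - l)) * t) := by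
      rw [← Complex.exp_add]; push_cast; ring_nf
    have e2 : Complex.exp (2 * Complex.I * ((j - l : ℤ) : ℂ) * t)
        = Complex.exp (Complex.I * (2 * (j - l)) * t) := by
      push_cast; ring_nf
    rw [e2, Real.rpow_add (sin_pos_of_mem_Ioo ht), Real.rpow_one, ← e1]
    push_cast
    generalize Complex.exp (2 * Complex.I * (-l) * t) = E
    generalize Complex.exp (Complex.I * (2 * j) * t) = E'
    generalize ((sin t ^ α : ℝ) : ℂ) = u
    generalize Complex.sin t = v
    generalize Complex.cos t = w
    field_simp
    linear_combination (-4 * E * E' * u * j * v * (j - l)) * Complex.I_mul_I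
  rw [intervalIntegral.integral_congr_Ioo_of_le pi_pos.le hcongr,
    intervalIntegral.integral_add
      ((intervalIntegrable_sin_rpow_mul (by linarith) (by fun_prop)).const_mul _)
      ((intervalIntegrable_sin_rpow_mul (by linarith) (by fun_prop)).const_mul _),
    intervalIntegral.integral_const_mul, intervalIntegral.integral_const_mul, h, mul_zero,
    add_zero, sinMoment]

theorem add_one_ne_two_mul_natCast {α : ℝ} (h0 : 0 < α) (h2 : α < 2) (h1 : α ≠ 1) (m : ℕ) :
    α + 1 ≠ 2 * m := by
  intro hm
  rcases m with _ | _ | m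
  · push_cast at hm; linarith
  · push_cast at hm; exact h1 (by linarith)
  · push_cast at hm
    have : (0 : ℝ) ≤ m := m.cast_nonneg
    linarith

theorem summable_mul_sinMoment {α : ℝ} (h0 : 0 < α) (h2 : α < 2) (h1 : α ≠ 1) (j : ℤ) :
    Summable fun l : ℤ => ((1 - α) * (2 * j) - 4 * l : ℂ) * sinMoment (α + 1) (j - l) := by
  have hne : ∀ m : ℕ, α + 1 ≠ 2 * m := add_one_ne_two_mul_natCast h0 h2 h1
  set C := √π * Gamma ((α + 1 + 1) / 2) / Gamma (-(α + 1) / 2)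
  have hs := summable_add_abs_mul_Gamma_div_Gamma (x := -(α + 1) / 2) (z := (α + 1) / 2 + 1)
    (by linarith) (by linarith)
  have hs' := (hs.comp_injective (sub_right_injective (b := j))).mul_left
    ((4 * |(j : ℝ)| + 4) * |C|)
  refine Summable.of_norm_bounded hs' fun l => ?_
  rw [sinMoment_eq (by linarith) hne, norm_mul, Complex.norm_real, Real.norm_eq_abs, abs_mul,
    Function.comp_apply]
  have hlin : ‖((1 - α) * (2 * j) - 4 * l : ℂ)‖
      ≤ (4 * |(j : ℝ)| + 4) * ((α + 1) / 2 + 1 - 1 + |((j - l : ℤ) : ℝ)|) := by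
    have e : ((1 - α) * (2 * j) - 4 * l : ℂ)
        = (((-2 * (1 + α)) * j + 4 * ((j - l : ℤ) : ℝ) : ℝ) : ℂ) := by push_cast; ring
    rw [e, Complex.norm_real, Real.norm_eq_abs]
    refine (abs_add_le _ _).trans ?_
    rw [abs_mul, abs_mul, abs_mul, abs_neg, abs_of_pos (by linarith : 0 < 1 + α)]
    have p1 := abs_nonneg (j : ℝ)
    have p2 := abs_nonneg ((j - l : ℤ) : ℝ)
    generalize |(j : ℝ)| = x at *
    generalize |((j - l : ℤ) : ℝ)| = y at *
    norm_num
    nlinarith [mul_nonneg p1 p2]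
  calc _ ≤ (4 * |(j : ℝ)| + 4) * ((α + 1) / 2 + 1 - 1 + |((j - l : ℤ) : ℝ)|) * _ :=
        mul_le_mul_of_nonneg_right hlin (by positivity)
    _ = _ := by ring

/-- Even-k case of formula (16) in Theorem 1 of the paper: Fourier series expansion. -/
theorem stmt_16 (α : ℝ) (hα : α ∈ Set.Ioo (0:ℝ) 1 ∪ Set.Ioo (1:ℝ) 2)
    (k : ℤ) (hk : Even k) (s : ℝ) (hs : s ∈ Set.Ioo 0 π) :
    Summable (fun l : ℤ =>
      ‖((Real.cot (π * α / 2) / 8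
            * (α * (1 - α) * ((1 - α) * (k : ℝ) ^ 2 - 4 * (k : ℝ) * (l : ℝ)))
            * (Real.Gamma ((α - 1) / 2 + |(l : ℝ)|)
                * Real.Gamma ((-1 - α) / 2 + |(k : ℝ) / 2 - (l : ℝ)|)
              / (Real.Gamma ((3 - α) / 2 + |(l : ℝ)|)
                * Real.Gamma ((3 + α) / 2 + |(k : ℝ) / 2 - (l : ℝ)|))) : ℝ) : ℂ)
        * Complex.exp (2 * Complex.I * (l : ℂ) * (s : ℂ))‖) ∧
    ∫ η in (0:ℝ)..π,
        ((Real.sin η ^ α : ℝ) : ℂ)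
          * (-(k : ℂ) ^ 2 * (Real.sin η : ℂ) + 2 * Complex.I * (k : ℂ) * (Real.cos η : ℂ))
          * Complex.exp (Complex.I * (k : ℂ) * (η : ℂ))
          * ((|Real.sin (s - η)| ^ (1 - α) : ℝ) : ℂ)
      = ∑' l : ℤ,
          ((Real.cot (π * α / 2) / 8
              * (α * (1 - α) * ((1 - α) * (k : ℝ) ^ 2 - 4 * (k : ℝ) * (l : ℝ)))
              * (Real.Gamma ((α - 1) / 2 + |(l : ℝ)|)
                  * Real.Gamma ((-1 - α) / 2 + |(k : ℝ) / 2 - (l : ℝ)|)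
                / (Real.Gamma ((3 - α) / 2 + |(l : ℝ)|)
                  * Real.Gamma ((3 + α) / 2 + |(k : ℝ) / 2 - (l : ℝ)|))) : ℝ) : ℂ)
            * Complex.exp (2 * Complex.I * (l : ℂ) * (s : ℂ)) := by
  obtain ⟨h0, h2, h1⟩ : 0 < α ∧ α < 2 ∧ α ≠ 1 := by
    rcases hα with h | h
    · exact ⟨h.1, by linarith [h.2], h.2.ne⟩
    · exact ⟨by linarith [h.1], h.2, h.1.ne'⟩
  obtain ⟨j, hj⟩ := hk.two_dvd
  have hkj : (k : ℂ) = 2 * j := by rw [hj]; push_cast; ring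
  have hkr : (k : ℝ) = 2 * j := by rw [hj]; push_cast; ring
  have hα1 : (α : ℂ) + 1 ≠ 0 := by
    have : α + 1 ≠ 0 := by linarith
    exact_mod_cast this
  have hπ : (π : ℂ) ≠ 0 := by exact_mod_cast pi_ne_zero
  set f : ℝ → ℂ := fun t => ((sin t ^ α : ℝ) : ℂ)
    * (-(2 * j : ℂ) ^ 2 * (sin t : ℂ) + 2 * Complex.I * (2 * j) * (cos t : ℂ))
    * Complex.exp (Complex.I * (2 * j) * t) with hf
  have hfcont : Continuous f := by
    have : Continuous fun t : ℝ => sin t ^ α :=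
      Real.continuous_sin.rpow_const fun _ => Or.inr h0.le
    rw [hf]
    fun_prop
  have hf0 : f 0 = f π := by simp [hf, Real.zero_rpow h0.ne']
  set c : ℤ → ℂ := fun l => 1 / π * (2 * j / (α + 1))
    * (((1 - α) * (2 * j) - 4 * l) * sinMoment (α + 1) (j - l)) with hc
  have hsum : Summable c := (summable_mul_sinMoment h0 h2 h1 j).mul_left _
  have hcoeff : ∀ l : ℤ, c l = 1 / π
      * ∫ t in (0 : ℝ)..π, Complex.exp (2 * Complex.I * (-l : ℤ) * t) * f t := by
    intro l
    rw [hf, integral_exp_mul_sin_rpow_mul h0]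
    ring
  have hfourier := fun x (hx : x ∈ Ioo 0 π) =>
    hasSum_fourier_of_summable hfcont.continuousOn hf0 hcoeff hsum (Ioo_subset_Ico_self hx)
  have key := hasSum_integral_mul_abs_sin_sub_rpow (b := 1 - α) (by linarith) hsum hfourier s
  have hne : ∀ m : ℕ, 1 - α ≠ 2 * m := by
    intro m hm
    rcases m with _ | m
    · push_cast at hm; exact h1 (by linarith)
    · push_cast at hm
      have : (0 : ℝ) ≤ m := m.cast_nonneg
      linarith
  have hne' : ∀ m : ℕ, α + 1 ≠ 2 * m := add_one_ne_two_mul_natCast h0 h2 h1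
  have hterm : ∀ l : ℤ, c l * sinMoment (1 - α) l
      = ((Real.cot (π * α / 2) / 8
            * (α * (1 - α) * ((1 - α) * (k : ℝ) ^ 2 - 4 * (k : ℝ) * (l : ℝ)))
            * (Real.Gamma ((α - 1) / 2 + |(l : ℝ)|)
                * Real.Gamma ((-1 - α) / 2 + |(k : ℝ) / 2 - (l : ℝ)|)
              / (Real.Gamma ((3 - α) / 2 + |(l : ℝ)|)
                * Real.Gamma ((3 + α) / 2 + |(k : ℝ) / 2 - (l : ℝ)|))) : ℝ) : ℂ) := by
    intro l
    have hconst := Gamma_mul_eq_cot h0 h2 h1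
    rw [hc]
    dsimp only
    rw [sinMoment_eq (by linarith) hne, sinMoment_eq (by linarith) hne', hkr,
      show (α - 1) / 2 = -(1 - α) / 2 by ring, show (-1 - α) / 2 = -(α + 1) / 2 by ring,
      show (3 - α) / 2 = (1 - α) / 2 + 1 by ring, show (3 + α) / 2 = (α + 1) / 2 + 1 by ring,
      show 2 * (j : ℝ) / 2 - l = ((j - l : ℤ) : ℝ) by push_cast; ring, mul_div_mul_comm]
    generalize Gamma (-(1 - α) / 2 + |(l : ℝ)|) / Gamma ((1 - α) / 2 + 1 + |(l : ℝ)|) = X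
    generalize Gamma (-(α + 1) / 2 + |((j - l : ℤ) : ℝ)|)
      / Gamma ((α + 1) / 2 + 1 + |((j - l : ℤ) : ℝ)|) = Y
    generalize √π * Gamma ((1 - α + 1) / 2) / Gamma (-(1 - α) / 2) = P at *
    generalize √π * Gamma ((α + 1 + 1) / 2) / Gamma (-(α + 1) / 2) = Q at *
    have hconst' : 1 / π / (α + 1) * ((P : ℂ) * Q)
        = (cot (π * α / 2) : ℝ) / 8 * (α * (1 - α)) := by
      have : (P : ℂ) * Q = π * (α + 1) * ((cot (π * α / 2) : ℝ) / 8 * (α * (1 - α))) := by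
        exact_mod_cast hconst
      rw [this]
      field_simp
    push_cast at hconst' ⊢
    linear_combination (2 * (j : ℂ) * ((1 - α) * (2 * j) - 4 * l) * X * Y) * hconst'
  simp_rw [hterm] at key
  refine ⟨key.summable.norm, ?_⟩
  rw [key.tsum_eq, hkj]
end
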